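/- arXiv:2212.00894 — 9 statements merged into one kernel-verified Lean document; each statement's English description precedes it below -/
import Mathlib

section
/- Let (X,d) be a metric space and let x₁, x₂, x₃, x₄, p, q ∈ X. If p ∈ [x₁,x₂] ∩ [x₃,x₄] and q ∈ [x₁,x₃] ∩ [x₂,x₄], then q ∈ [x₁,x₂] ∩ [x₃,x₄]. (This is the metric content of the paper's 'square or butterfly' lemma: in a CAT(0) space, if the geodesic segments x₁x₂ and x₃x₄ intersect, then the intersection of the geodesics x₁x₃ and x₂x₄ is contained in the intersection of x₁x₂ and x₃x₄.) -/
/-- The metric interval between `x` and `y`: points `z` with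
`d(x,z) + d(z,y) = d(x,y)`. -/
def mInterval {X : Type*} [MetricSpace X] (x y : X) : Set X :=
  {z | dist x z + dist z y = dist x y}

/-- Square or butterfly lemma, metric content: if `p ∈ [x₁,x₂] ∩ [x₃,x₄]` and
`q ∈ [x₁,x₃] ∩ [x₂,x₄]`, then `q ∈ [x₁,x₂] ∩ [x₃,x₄]`. -/
theorem square_or_butterfly {X : Type*} [MetricSpace X] (x₁ x₂ x₃ x₄ p q : X)
    (hp : p ∈ mInterval x₁ x₂ ∩ mInterval x₃ x₄)
    (hq : q ∈ mInterval x₁ x₃ ∩ mInterval x₂ x₄) :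
    q ∈ mInterval x₁ x₂ ∩ mInterval x₃ x₄ := by
  simp only [mInterval, Set.mem_inter_iff, Set.mem_ofPred_eq] at *
  have h₁₂ := dist_triangle x₁ q x₂
  have h₃₄ := dist_triangle x₃ q x₄
  have h₁₃ := dist_triangle x₁ p x₃
  have h₂₄ := dist_triangle x₂ p x₄
  have c₂ := dist_comm p x₂
  have c₃ := dist_comm p x₃
  have d₂ := dist_comm q x₂
  have d₃ := dist_comm q x₃
  constructor <;> linarith
end

section
/- Let (X,d) be a metric space and let x₁, x₂, x₃, x₄, p, q ∈ X. If p ∈ [x₁,x₂] ∩ [x₃,x₄] and q ∈ [x₁,x₃] ∩ [x₂,x₄], then also p ∈ [x₁,x₃] ∩ [x₂,x₄]. (In the proof of the paper's 'square or butterfly' lemma, summing the four triangle inequalities shows that all of them are equalities; in particular the point p on the intersection of the first pair of intervals also lies on the intersection of the second pair.) -/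
/-- If `p ∈ [x₁,x₂] ∩ [x₃,x₄]` and `q ∈ [x₁,x₃] ∩ [x₂,x₄]`, then also
`p ∈ [x₁,x₃] ∩ [x₂,x₄]`. -/
theorem square_or_butterfly_symm {X : Type*} [MetricSpace X] (x₁ x₂ x₃ x₄ p q : X)
    (hp : p ∈ mInterval x₁ x₂ ∩ mInterval x₃ x₄)
    (hq : q ∈ mInterval x₁ x₃ ∩ mInterval x₂ x₄) :
    p ∈ mInterval x₁ x₃ ∩ mInterval x₂ x₄ := by
  obtain ⟨hp₁₂, hp₃₄⟩ := hp
  obtain ⟨hq₁₃, hq₂₄⟩ := hq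
  simp only [mInterval, Set.mem_inter_iff, Set.mem_ofPred_eq] at *
  have h₁₂ := dist_triangle x₁ q x₂
  have h₃₄ := dist_triangle x₃ q x₄
  have h₁₃ := dist_triangle x₁ p x₃
  have h₂₄ := dist_triangle x₂ p x₄
  rw [dist_comm q x₂] at h₁₂
  rw [dist_comm x₃ q] at h₃₄
  rw [dist_comm p x₃] at h₁₃ ⊢
  rw [dist_comm x₂ p] at h₂₄ ⊢
  constructor <;> linarith
end

section
/- Let (X,d) be a metric space and let x₁, x₂, x₃, x₄ ∈ X. If both [x₁,x₂] ∩ [x₃,x₄] and [x₁,x₃] ∩ [x₂,x₄] are nonempty, then [x₁,x₂] ∩ [x₃,x₄] = [x₁,x₃] ∩ [x₂,x₄]. (This is the 'hence' clause of the paper's 'square or butterfly' lemma: for {i,j,k,l} = {i',j',k',l'} = {1,2,3,4}, the intersections [x_i,x_j] ∩ [x_k,x_l] and [x_{i'},x_{j'}] ∩ [x_{k'},x_{l'}] coincide whenever both are nonempty.) -/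
/-- A common point of `[x₁,x₂]` and `[x₃,x₄]` bounds `d(x₁,x₃) + d(x₂,x₄)`
by `d(x₁,x₂) + d(x₃,x₄)`. -/
theorem dist_add_dist_le_of_mem_mInterval {X : Type*} [MetricSpace X] {x₁ x₂ x₃ x₄ p : X}
    (hp : p ∈ mInterval x₁ x₂ ∩ mInterval x₃ x₄) :
    dist x₁ x₃ + dist x₂ x₄ ≤ dist x₁ x₂ + dist x₃ x₄ := by
  simp only [mInterval, Set.mem_inter_iff, Set.mem_ofPred_eq] at hp
  linarith [dist_triangle x₁ p x₃, dist_triangle x₂ p x₄,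
    dist_comm p x₂, dist_comm p x₃]

/-- If `d(x₁,x₂) + d(x₃,x₄) ≤ d(x₁,x₃) + d(x₂,x₄)`, then
`[x₁,x₂] ∩ [x₃,x₄] ⊆ [x₁,x₃] ∩ [x₂,x₄]`. -/
theorem mInterval_inter_subset_of_dist_le {X : Type*} [MetricSpace X] {x₁ x₂ x₃ x₄ : X}
    (h : dist x₁ x₂ + dist x₃ x₄ ≤ dist x₁ x₃ + dist x₂ x₄) :
    mInterval x₁ x₂ ∩ mInterval x₃ x₄ ⊆ mInterval x₁ x₃ ∩ mInterval x₂ x₄ := by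
  intro p hp
  simp only [mInterval, Set.mem_inter_iff, Set.mem_ofPred_eq] at hp ⊢
  have h₁₃ := dist_triangle x₁ p x₃
  have h₂₄ := dist_triangle x₂ p x₄
  rw [dist_comm p x₂, dist_comm x₃ p] at hp
  constructor <;> linarith

/-- If `[x₁,x₂] ∩ [x₃,x₄]` and `[x₁,x₃] ∩ [x₂,x₄]` are both nonempty,
then they coincide. -/
theorem square_or_butterfly_eq {X : Type*} [MetricSpace X] (x₁ x₂ x₃ x₄ : X)
    (h₁ : (mInterval x₁ x₂ ∩ mInterval x₃ x₄).Nonempty)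
    (h₂ : (mInterval x₁ x₃ ∩ mInterval x₂ x₄).Nonempty) :
    mInterval x₁ x₂ ∩ mInterval x₃ x₄ = mInterval x₁ x₃ ∩ mInterval x₂ x₄ := by
  obtain ⟨p, hp⟩ := h₁
  obtain ⟨q, hq⟩ := h₂
  exact Set.Subset.antisymm
    (mInterval_inter_subset_of_dist_le (dist_add_dist_le_of_mem_mInterval hq))
    (mInterval_inter_subset_of_dist_le (dist_add_dist_le_of_mem_mInterval hp))
end

section
/- Let V be a real inner product space and let x₁, x₂, x₃, x₄ ∈ V. If the closed segments [x₁,x₂] and [x₃,x₄] intersect, then [x₁,x₃] ∩ [x₂,x₄] ⊆ [x₁,x₂] ∩ [x₃,x₄]. (This is the 'square or butterfly' lemma in the special CAT(0) space given by an inner product space, where geodesic segments are exactly the closed line segments.) -/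
/-- Square or butterfly lemma in a real inner product space: if the segments
`[x₁,x₂]` and `[x₃,x₄]` intersect, then `[x₁,x₃] ∩ [x₂,x₄] ⊆ [x₁,x₂] ∩ [x₃,x₄]`. -/
theorem square_or_butterfly_inner {V : Type*} [NormedAddCommGroup V]
    [InnerProductSpace ℝ V] (x₁ x₂ x₃ x₄ : V)
    (h : (segment ℝ x₁ x₂ ∩ segment ℝ x₃ x₄).Nonempty) :
    segment ℝ x₁ x₃ ∩ segment ℝ x₂ x₄ ⊆ segment ℝ x₁ x₂ ∩ segment ℝ x₃ x₄ := by
  obtain ⟨p, hp₁₂, hp₃₄⟩ := h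
  rintro q ⟨hq₁₃, hq₂₄⟩
  simp only [Set.mem_inter_iff, mem_segment_iff_wbtw, ← dist_add_dist_eq_iff] at *
  have h₁₃ := dist_triangle x₁ p x₃
  have h₂₄ := dist_triangle x₂ p x₄
  have h₁₂ := dist_triangle x₁ q x₂
  have h₃₄ := dist_triangle x₃ q x₄
  rw [dist_comm p x₃] at h₁₃
  rw [dist_comm x₂ p] at h₂₄
  rw [dist_comm q x₂] at h₁₂ ⊢
  rw [dist_comm x₃ q] at h₃₄ ⊢
  constructor <;> linarith
end

section
/- Let x₁, x₂, x₃, x₄ be four points in the Euclidean plane ℝ² that do not all lie on a common affine line. Then the intersection of the four full triangles they span, ⋂_{1 ≤ i < j < k ≤ 4} conv{x_i, x_j, x_k}, is a single point. -/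
/-- Membership in the convex hull of a subfamily, through weights that vanish off the subfamily. -/
theorem mem_convexHull_image_iff_exists_weights {ι E : Type*} [Fintype ι] [AddCommGroup E]
    [Module ℝ E] (x : ι → E) (s : Set ι) (p : E) :
    p ∈ convexHull ℝ (x '' s) ↔
      ∃ w : ι → ℝ, (∀ i, 0 ≤ w i) ∧ (∀ i, i ∉ s → w i = 0) ∧ ∑ i, w i = 1 ∧
        ∑ i, w i • x i = p := by
  classical
  constructor
  · intro hp
    refine convexHull_min (t := {p | ∃ w : ι → ℝ, (∀ i, 0 ≤ w i) ∧ (∀ i, i ∉ s → w i = 0) ∧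
        ∑ i, w i = 1 ∧ ∑ i, w i • x i = p}) ?_ ?_ hp
    · rintro _ ⟨i, hi, rfl⟩
      refine ⟨Pi.single i 1, fun j => ?_, fun j hj => ?_, ?_, ?_⟩
      · by_cases h : j = i
        · subst h; simp
        · simp [h]
      · have : j ≠ i := fun h => hj (h ▸ hi)
        simp [this]
      · simp
      · simp [Pi.single_apply]
    · rintro _ ⟨u, hu, hu0, hu1, rfl⟩ _ ⟨v, hv, hv0, hv1, rfl⟩ a b ha hb hab
      refine ⟨fun i => a * u i + b * v i, fun i => ?_, fun i hi => ?_, ?_, ?_⟩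
      · have := hu i; have := hv i; positivity
      · simp [hu0 i hi, hv0 i hi]
      · simp [Finset.sum_add_distrib, ← Finset.mul_sum, hu1, hv1, hab]
      · simp [Finset.sum_add_distrib, add_smul, mul_smul, Finset.smul_sum]
  · rintro ⟨w, hw, hw0, hw1, rfl⟩
    have h1 : ∑ i with i ∈ s, w i = 1 := by
      rw [← hw1]
      exact Finset.sum_subset (Finset.subset_univ _) fun i _ hi => hw0 i (by simpa using hi)
    have h2 : ∑ i with i ∈ s, w i • x i = ∑ i, w i • x i :=
      Finset.sum_subset (Finset.subset_univ _) fun i _ hi => by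
        rw [hw0 i (by simpa using hi), zero_smul]
    rw [← h2]
    refine (convex_convexHull ℝ _).sum_mem (fun i _ => hw i) h1 fun i hi => ?_
    exact subset_convexHull ℝ _ ⟨i, by simpa using hi, rfl⟩

/-- If the affine dependences of a finite family form a line, then the convex hulls of the
subfamilies omitting one member have exactly one common point. -/
theorem exists_iInter_convexHull_compl_singleton_eq {ι E : Type*} [Fintype ι]
    [AddCommGroup E] [Module ℝ E] (x : ι → E) (c : ι → ℝ) (hc : c ≠ 0)
    (hc0 : ∑ i, c i = 0) (hcx : ∑ i, c i • x i = 0)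
    (huniq : ∀ d : ι → ℝ, ∑ i, d i = 0 → ∑ i, d i • x i = 0 → ∃ t : ℝ, d = t • c) :
    ∃ p, ⋂ i, convexHull ℝ (x '' {i}ᶜ) = {p} := by
  obtain ⟨k, hk⟩ : ∃ k, c k < 0 := by
    by_contra! h
    exact hc (funext fun i =>
      (Finset.sum_eq_zero_iff_of_nonneg fun i _ => h i).1 hc0 i (Finset.mem_univ i))
  obtain ⟨l, hl⟩ : ∃ l, 0 < c l := by
    by_contra! h
    exact hc (funext fun i =>
      (Finset.sum_eq_zero_iff_of_nonpos fun i _ => h i).1 hc0 i (Finset.mem_univ i))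
  set m := ∑ i, (c i)⁻ with hm
  have hmpos : 0 < m := Finset.sum_pos' (fun i _ => negPart_nonneg _)
    ⟨k, Finset.mem_univ k, negPart_pos hk⟩
  have hadd : ∀ i, (c i)⁺ = c i + (c i)⁻ := fun i => by
    linarith [posPart_sub_negPart (c i)]
  have hm' : ∑ i, (c i)⁺ = m := by
    simp [hadd, Finset.sum_add_distrib, hc0, hm]
  have hmx : ∑ i, (c i)⁺ • x i = ∑ i, (c i)⁻ • x i := by
    simp [hadd, add_smul, Finset.sum_add_distrib, hcx]
  refine ⟨m⁻¹ • ∑ i, (c i)⁻ • x i, Set.eq_singleton_iff_unique_mem.2 ⟨?_, ?_⟩⟩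
  · refine Set.mem_iInter.2 fun i => (mem_convexHull_image_iff_exists_weights _ _ _).2 ?_
    rcases lt_or_ge (c i) 0 with hi | hi
    · refine ⟨fun j => m⁻¹ * (c j)⁺, fun j => ?_, fun j hj => ?_, ?_, ?_⟩
      · have := posPart_nonneg (c j); positivity
      · obtain rfl : j = i := by simpa using hj
        simp [posPart_eq_zero.2 hi.le]
      · rw [← Finset.mul_sum, hm', inv_mul_cancel₀ hmpos.ne']
      · simp [mul_smul, ← Finset.smul_sum, hmx]
    · refine ⟨fun j => m⁻¹ * (c j)⁻, fun j => ?_, fun j hj => ?_, ?_, ?_⟩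
      · have := negPart_nonneg (c j); positivity
      · obtain rfl : j = i := by simpa using hj
        simp [negPart_eq_zero.2 hi]
      · rw [← Finset.mul_sum, inv_mul_cancel₀ hmpos.ne']
      · simp [mul_smul, ← Finset.smul_sum]
  · intro p hp
    have hw := fun i => (mem_convexHull_image_iff_exists_weights _ _ _).1 (Set.mem_iInter.1 hp i)
    choose w hw hw0 hw1 hwx using hw
    replace hw0 : ∀ i, w i i = 0 := fun i => hw0 i i (by simp)
    have hdiff : ∀ i j, ∃ t : ℝ, ∀ n, w j n = w i n + t * c n := by
      intro i j
      obtain ⟨t, ht⟩ := huniq (fun n => w j n - w i n) (by simp [hw1])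
        (by simp [sub_smul, hwx])
      refine ⟨t, fun n => ?_⟩
      have := congrFun ht n
      simp only [Pi.smul_apply, smul_eq_mul] at this
      linarith
    have hpos : ∀ j, 0 < c j → w l j = 0 := by
      intro j hj
      obtain ⟨t, ht⟩ := hdiff l j
      have h1 := ht l
      have h2 := ht j
      rw [hw0] at h1 h2
      have h3 : 0 ≤ t := by
        by_contra! h
        nlinarith [hw j l]
      nlinarith [hw l j]
    have hneg : ∀ j, c j < 0 → w k j = 0 := by
      intro j hj
      obtain ⟨t, ht⟩ := hdiff k j
      have h1 := ht k
      have h2 := ht j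
      rw [hw0] at h1 h2
      have h3 : t ≤ 0 := by
        by_contra! h
        nlinarith [hw j k]
      nlinarith [hw k j]
    obtain ⟨s, hs⟩ := hdiff l k
    have hwl : ∀ j, w l j = s * (c j)⁻ := by
      intro j
      rcases lt_trichotomy (c j) 0 with hj | hj | hj
      · have := hs j
        rw [hneg j hj] at this
        rw [negPart_of_nonpos hj.le]
        linarith
      · obtain ⟨t, ht⟩ := hdiff l j
        have := ht j
        rw [hw0, hj] at this
        rw [hj, negPart_zero]
        linarith
      · rw [hpos j hj, negPart_eq_zero.2 hj.le, mul_zero]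
    have hsm : s * m = 1 := by
      rw [hm, Finset.mul_sum, ← hw1 l]
      exact Finset.sum_congr rfl fun j _ => (hwl j).symm
    rw [← hwx l, ← eq_inv_of_mul_eq_one_left hsm, Finset.smul_sum]
    exact Finset.sum_congr rfl fun j _ => by rw [hwl, mul_smul]

/-- The affine dependences of an affinely spanning family of `finrank ℝ E + 2` points form a
line. -/
theorem exists_affine_dependence_unique_up_to_smul {ι E : Type*} [Fintype ι] [AddCommGroup E]
    [Module ℝ E] [FiniteDimensional ℝ E] (x : ι → E) (i₀ : ι)
    (hcard : Fintype.card ι = Module.finrank ℝ E + 2)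
    (hspan : vectorSpan ℝ (Set.range x) = ⊤) :
    ∃ c : ι → ℝ, c ≠ 0 ∧ ∑ i, c i = 0 ∧ ∑ i, c i • x i = 0 ∧
      ∀ d : ι → ℝ, ∑ i, d i = 0 → ∑ i, d i • x i = 0 → ∃ t : ℝ, d = t • c := by
  classical
  let L : (ι → ℝ) →ₗ[ℝ] ℝ × E := Fintype.linearCombination ℝ fun i => ((1 : ℝ), x i)
  have hL : ∀ d, L d = (∑ i, d i, ∑ i, d i • x i) := fun d => by
    simp [L, Fintype.linearCombination_apply, Prod.ext_iff, Prod.fst_sum, Prod.snd_sum]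
  have hsingle : ∀ i, L (Pi.single i 1) = (1, x i) := fun i => by
    simp [L]
  have hv : ∀ v : E, ((0 : ℝ), v) ∈ LinearMap.range L := by
    have : vectorSpan ℝ (Set.range x) ≤ (LinearMap.range L).comap (LinearMap.inr ℝ ℝ E) := by
      rw [vectorSpan_range_eq_span_range_vsub_right ℝ x i₀, Submodule.span_le]
      rintro _ ⟨i, rfl⟩
      exact ⟨Pi.single i 1 - Pi.single i₀ 1, by simp [hsingle]⟩
    intro v
    exact this (hspan ▸ Submodule.mem_top)
  have hrange : LinearMap.range L = ⊤ := by
    refine eq_top_iff.2 fun ⟨a, v⟩ _ => ?_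
    have h := add_mem ((LinearMap.range L).smul_mem a ⟨Pi.single i₀ 1, hsingle i₀⟩)
      (hv (v - a • x i₀))
    simpa using h
  have hker : Module.finrank ℝ (LinearMap.ker L) = 1 := by
    have := LinearMap.finrank_range_add_finrank_ker L
    rw [hrange, finrank_top, Module.finrank_prod, Module.finrank_self,
      Module.finrank_fintype_fun_eq_card, hcard] at this
    omega
  obtain ⟨⟨c, hcL⟩, hc, hcu⟩ := finrank_eq_one_iff'.1 hker
  have hcL' := hcL
  rw [LinearMap.mem_ker, hL, Prod.mk_eq_zero] at hcL'
  refine ⟨c, fun h => hc (Subtype.ext h), hcL'.1, hcL'.2, fun d hd hdx => ?_⟩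
  obtain ⟨t, ht⟩ := hcu ⟨d, by rw [LinearMap.mem_ker, hL, hd, hdx]; rfl⟩
  exact ⟨t, (congrArg Subtype.val ht).symm⟩

/-- If four points of the Euclidean plane do not all lie on a common affine
line, then the intersection of the four full triangles (convex hulls of the
three-element subsets) they span is a single point. -/
theorem four_triangles_inter_singleton
    (x₁ x₂ x₃ x₄ : EuclideanSpace ℝ (Fin 2))
    (h : ¬ Collinear ℝ ({x₁, x₂, x₃, x₄} : Set (EuclideanSpace ℝ (Fin 2)))) :
    ∃ p : EuclideanSpace ℝ (Fin 2),
      convexHull ℝ {x₁, x₂, x₃} ∩ convexHull ℝ {x₁, x₂, x₄} ∩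
        convexHull ℝ {x₁, x₃, x₄} ∩ convexHull ℝ {x₂, x₃, x₄} = {p} := by
  have hr : Set.range ![x₁, x₂, x₃, x₄] = {x₁, x₂, x₃, x₄} := by
    ext y; simp; tauto
  have hspan : vectorSpan ℝ (Set.range ![x₁, x₂, x₃, x₄]) = ⊤ := by
    rw [← hr, collinear_iff_finrank_le_one, not_le] at h
    refine Submodule.eq_top_of_finrank_eq (le_antisymm (Submodule.finrank_le _) ?_)
    rw [finrank_euclideanSpace_fin]
    exact h
  obtain ⟨c, hc, hc0, hcx, huniq⟩ :=
    exists_affine_dependence_unique_up_to_smul ![x₁, x₂, x₃, x₄] 0 (by simp) hspan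
  obtain ⟨p, hp⟩ := exists_iInter_convexHull_compl_singleton_eq _ c hc hc0 hcx huniq
  refine ⟨p, ?_⟩
  have h0 : ![x₁, x₂, x₃, x₄] '' {0}ᶜ = {x₂, x₃, x₄} := by
    rw [show ({0}ᶜ : Set (Fin 4)) = {1, 2, 3} by ext i; fin_cases i <;> simp]
    simp [Set.image_insert_eq]
  have h1 : ![x₁, x₂, x₃, x₄] '' {1}ᶜ = {x₁, x₃, x₄} := by
    rw [show ({1}ᶜ : Set (Fin 4)) = {0, 2, 3} by ext i; fin_cases i <;> simp]
    simp [Set.image_insert_eq]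
  have h2 : ![x₁, x₂, x₃, x₄] '' {2}ᶜ = {x₁, x₂, x₄} := by
    rw [show ({2}ᶜ : Set (Fin 4)) = {0, 1, 3} by ext i; fin_cases i <;> simp]
    simp [Set.image_insert_eq]
  have h3 : ![x₁, x₂, x₃, x₄] '' {3}ᶜ = {x₁, x₂, x₃} := by
    rw [show ({3}ᶜ : Set (Fin 4)) = {0, 1, 2} by ext i; fin_cases i <;> simp]
    simp [Set.image_insert_eq]
  rw [← hp, ← h0, ← h1, ← h2, ← h3]
  ext y
  simp only [Set.mem_inter_iff, Set.mem_iInter, Fin.forall_fin_succ]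
  simp
  tauto
end

section
/- Let x₁, x₂, x₃, x₄ be four points in the Euclidean plane ℝ² that all lie on a common affine line. Then ⋂_{1 ≤ i < j < k ≤ 4} conv{x_i, x_j, x_k} = ([x₁,x₂] ∩ [x₃,x₄]) ∪ ([x₁,x₃] ∩ [x₂,x₄]) ∪ ([x₁,x₄] ∩ [x₂,x₃]); that is, the intersection of the four full triangles equals the union over the three pairings {i,j},{k,l} of {1,2,3,4} of the intersections of opposite segments, and it equals [x_i,x_j] ∩ [x_k,x_l] for each pairing for which this intersection is nonempty. -/
theorem Real.mem_convexHull_triple {a b c x : ℝ} :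
    x ∈ convexHull ℝ {a, b, c} ↔
      (a ≤ x ∨ b ≤ x ∨ c ≤ x) ∧ (x ≤ a ∨ x ≤ b ∨ x ≤ c) := by
  constructor
  · intro hx
    have hsub : convexHull ℝ {a, b, c} ⊆ Set.Icc (min a (min b c)) (max a (max b c)) :=
      convexHull_min (by rintro y (rfl | rfl | rfl) <;> simp) (convex_Icc _ _)
    simpa using hsub hx
  · have hsub := subset_convexHull ℝ ({a, b, c} : Set ℝ)
    have ha : a ∈ convexHull ℝ {a, b, c} := hsub (by simp)
    have hb : b ∈ convexHull ℝ {a, b, c} := hsub (by simp)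
    have hc : c ∈ convexHull ℝ {a, b, c} := hsub (by simp)
    have hord := (convex_convexHull ℝ ({a, b, c} : Set ℝ)).ordConnected
    rintro ⟨h₁ | h₁ | h₁, h₂ | h₂ | h₂⟩ <;> exact hord.out ‹_› ‹_› ⟨h₁, h₂⟩

theorem Real.mem_segment {a b x : ℝ} :
    x ∈ segment ℝ a b ↔ (a ≤ x ∨ b ≤ x) ∧ (x ≤ a ∨ x ≤ b) := by
  rw [segment_eq_uIcc, Set.mem_uIcc]
  grind

theorem Real.four_triangles_inter
    (x₁ x₂ x₃ x₄ : ℝ) :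
    (convexHull ℝ {x₁, x₂, x₃} ∩ convexHull ℝ {x₁, x₂, x₄} ∩
        convexHull ℝ {x₁, x₃, x₄} ∩ convexHull ℝ {x₂, x₃, x₄} =
      (segment ℝ x₁ x₂ ∩ segment ℝ x₃ x₄) ∪
        (segment ℝ x₁ x₃ ∩ segment ℝ x₂ x₄) ∪
        (segment ℝ x₁ x₄ ∩ segment ℝ x₂ x₃)) ∧
    ((segment ℝ x₁ x₂ ∩ segment ℝ x₃ x₄).Nonempty →
      convexHull ℝ {x₁, x₂, x₃} ∩ convexHull ℝ {x₁, x₂, x₄} ∩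
        convexHull ℝ {x₁, x₃, x₄} ∩ convexHull ℝ {x₂, x₃, x₄} =
        segment ℝ x₁ x₂ ∩ segment ℝ x₃ x₄) ∧
    ((segment ℝ x₁ x₃ ∩ segment ℝ x₂ x₄).Nonempty →
      convexHull ℝ {x₁, x₂, x₃} ∩ convexHull ℝ {x₁, x₂, x₄} ∩
        convexHull ℝ {x₁, x₃, x₄} ∩ convexHull ℝ {x₂, x₃, x₄} =
        segment ℝ x₁ x₃ ∩ segment ℝ x₂ x₄) ∧
    ((segment ℝ x₁ x₄ ∩ segment ℝ x₂ x₃).Nonempty →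
      convexHull ℝ {x₁, x₂, x₃} ∩ convexHull ℝ {x₁, x₂, x₄} ∩
        convexHull ℝ {x₁, x₃, x₄} ∩ convexHull ℝ {x₂, x₃, x₄} =
        segment ℝ x₁ x₄ ∩ segment ℝ x₂ x₃) := by
  simp only [Set.ext_iff, Set.Nonempty, Set.mem_inter_iff, Set.mem_union,
    Real.mem_convexHull_triple, Real.mem_segment]
  refine ⟨?_, ?_, ?_, ?_⟩
  · intro x
    grind
  all_goals
    rintro ⟨y, hy⟩ x
    grind

/-- For four collinear points of the Euclidean plane, the intersection of the
four full triangles equals the union of the three intersections of opposite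
segments, and equals each such intersection which is nonempty. -/
theorem four_triangles_inter_collinear
    (x₁ x₂ x₃ x₄ : EuclideanSpace ℝ (Fin 2))
    (h : Collinear ℝ ({x₁, x₂, x₃, x₄} : Set (EuclideanSpace ℝ (Fin 2)))) :
    (convexHull ℝ {x₁, x₂, x₃} ∩ convexHull ℝ {x₁, x₂, x₄} ∩
        convexHull ℝ {x₁, x₃, x₄} ∩ convexHull ℝ {x₂, x₃, x₄} =
      (segment ℝ x₁ x₂ ∩ segment ℝ x₃ x₄) ∪
        (segment ℝ x₁ x₃ ∩ segment ℝ x₂ x₄) ∪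
        (segment ℝ x₁ x₄ ∩ segment ℝ x₂ x₃)) ∧
    ((segment ℝ x₁ x₂ ∩ segment ℝ x₃ x₄).Nonempty →
      convexHull ℝ {x₁, x₂, x₃} ∩ convexHull ℝ {x₁, x₂, x₄} ∩
        convexHull ℝ {x₁, x₃, x₄} ∩ convexHull ℝ {x₂, x₃, x₄} =
        segment ℝ x₁ x₂ ∩ segment ℝ x₃ x₄) ∧
    ((segment ℝ x₁ x₃ ∩ segment ℝ x₂ x₄).Nonempty →
      convexHull ℝ {x₁, x₂, x₃} ∩ convexHull ℝ {x₁, x₂, x₄} ∩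
        convexHull ℝ {x₁, x₃, x₄} ∩ convexHull ℝ {x₂, x₃, x₄} =
        segment ℝ x₁ x₃ ∩ segment ℝ x₂ x₄) ∧
    ((segment ℝ x₁ x₄ ∩ segment ℝ x₂ x₃).Nonempty →
      convexHull ℝ {x₁, x₂, x₃} ∩ convexHull ℝ {x₁, x₂, x₄} ∩
        convexHull ℝ {x₁, x₃, x₄} ∩ convexHull ℝ {x₂, x₃, x₄} =
        segment ℝ x₁ x₄ ∩ segment ℝ x₂ x₃) := by
  obtain ⟨p, v, hv⟩ := (collinear_iff_exists_forall_eq_smul_vadd _).1 h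
  obtain ⟨r₁, h₁⟩ := hv x₁ (by simp)
  obtain ⟨r₂, h₂⟩ := hv x₂ (by simp)
  obtain ⟨r₃, h₃⟩ := hv x₃ (by simp)
  obtain ⟨r₄, h₄⟩ := hv x₄ (by simp)
  by_cases hv₀ : v = 0
  · simp [h₁, h₂, h₃, h₄, hv₀]
  let f : ℝ →ᵃ[ℝ] EuclideanSpace ℝ (Fin 2) := AffineMap.lineMap p (v +ᵥ p)
  have hf (r : ℝ) : f r = r • v +ᵥ p := by simp [f, AffineMap.lineMap_apply]
  have hinj : Function.Injective f := AffineMap.lineMap_injective ℝ (by simpa using hv₀)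
  have htri (a b c : ℝ) :
      convexHull ℝ {f a, f b, f c} = f '' convexHull ℝ {a, b, c} := by
    rw [f.image_convexHull, Set.image_insert_eq, Set.image_pair]
  rw [← hf] at h₁ h₂ h₃ h₄
  subst h₁ h₂ h₃ h₄
  simp only [htri, ← image_segment, ← Set.image_inter hinj, ← Set.image_union,
    Set.image_nonempty, hinj.image_injective.eq_iff]
  exact Real.four_triangles_inter r₁ r₂ r₃ r₄
end

section
/- The Euclidean plane ℝ² is 2-median in the following sense: for any four points x₁, x₂, x₃, x₄ ∈ ℝ², either there is a pairing {i,j,k,l} = {1,2,3,4} such that [x_i,x_j] ∩ [x_k,x_l] contains at least two points (a nondegenerate segment), in which case ⋂_{1 ≤ i < j < k ≤ 4} conv{x_i, x_j, x_k} = [x_i,x_j] ∩ [x_k,x_l], or else ⋂_{1 ≤ i < j < k ≤ 4} conv{x_i, x_j, x_k} is a single point. -/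
/-- Points of the convex hull of a subfamily are the convex combinations supported on it. -/
theorem mem_convexHull_image_compl_singleton {ι E : Type*} [Fintype ι] [AddCommGroup E]
    [Module ℝ E] {x : ι → E} {i : ι} {p : E} :
    p ∈ convexHull ℝ (x '' {i}ᶜ) ↔
      ∃ w : ι → ℝ, (∀ j, 0 ≤ w j) ∧ w i = 0 ∧ ∑ j, w j = 1 ∧ ∑ j, w j • x j = p := by
  classical
  constructor
  · intro hp
    refine convexHull_min (t := {p | ∃ w : ι → ℝ, (∀ j, 0 ≤ w j) ∧ w i = 0 ∧ ∑ j, w j = 1 ∧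
      ∑ j, w j • x j = p}) ?_ ?_ hp
    · rintro _ ⟨j, hj, rfl⟩
      refine ⟨Pi.single j 1, fun k => ?_, ?_, by simp, by simp [Pi.single_apply]⟩
      · by_cases h : k = j <;> simp [h]
      · exact Pi.single_eq_of_ne (Ne.symm hj) _
    · rintro _ ⟨u, hu, hui, hu1, rfl⟩ _ ⟨w, hw, hwi, hw1, rfl⟩ a b ha hb hab
      refine ⟨fun j => a * u j + b * w j, fun j => ?_, by simp [hui, hwi], ?_, ?_⟩
      · have := mul_nonneg ha (hu j)
        have := mul_nonneg hb (hw j)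
        linarith
      · rw [Finset.sum_add_distrib, ← Finset.mul_sum, ← Finset.mul_sum, hu1, hw1]
        linarith
      · simp only [add_smul, mul_smul, Finset.sum_add_distrib, Finset.smul_sum]
  · rintro ⟨w, hw, hwi, hw1, rfl⟩
    rw [← Finset.sum_erase (a := i) _ (by simp [hwi])]
    rw [← Finset.sum_erase (a := i) _ hwi] at hw1
    refine (convex_convexHull ℝ _).sum_mem (fun j _ => hw j) hw1 fun j hj => ?_
    exact subset_convexHull ℝ _ ⟨j, by simpa using hj, rfl⟩

/-- If a finite family has, up to scaling, exactly one nontrivial affine dependency, then the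
convex hulls of the subfamilies omitting one point meet exactly in the Radon point. -/
theorem exists_iInter_convexHull_eq_singleton {ι E : Type*} [Fintype ι] [AddCommGroup E]
    [Module ℝ E] (x : ι → E) (d : ι → ℝ) (hd : d ≠ 0) (hd0 : ∑ i, d i = 0)
    (hdx : ∑ i, d i • x i = 0)
    (huniq : ∀ w : ι → ℝ, ∑ i, w i = 0 → ∑ i, w i • x i = 0 → ∃ c : ℝ, ∀ i, w i = c * d i) :
    ∃ p, ⋂ i, convexHull ℝ (x '' {i}ᶜ) = {p} := by
  obtain ⟨k, hk⟩ := Function.ne_iff.1 hd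
  obtain ⟨a, -, ha⟩ := Finset.exists_pos_of_sum_zero_of_exists_nonzero d hd0
    ⟨k, Finset.mem_univ k, hk⟩
  obtain ⟨b, -, hb⟩ := Finset.exists_pos_of_sum_zero_of_exists_nonzero (fun i => -d i)
    (by simpa using hd0) ⟨k, Finset.mem_univ k, by simpa using hk⟩
  rw [Left.neg_pos_iff] at hb
  set S : ℝ := ∑ i, max (d i) 0 with hS
  have hSpos : 0 < S :=
    Finset.sum_pos' (fun i _ => le_max_right _ _) ⟨a, Finset.mem_univ a, lt_max_of_lt_left ha⟩
  have hsplit (i : ι) : max (d i) 0 - max (-d i) 0 = d i := by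
    rcases le_total (d i) 0 with h | h <;> simp [h]
  have hS' : ∑ i, max (-d i) 0 = S := by
    have : S - ∑ i, max (-d i) 0 = 0 := by
      rw [hS, ← Finset.sum_sub_distrib, Finset.sum_congr rfl fun i _ => hsplit i, hd0]
    linarith
  have hx' : ∑ i, max (-d i) 0 • x i = ∑ i, max (d i) 0 • x i := by
    refine (sub_eq_zero.1 ?_).symm
    rw [← Finset.sum_sub_distrib, ← hdx]
    exact Finset.sum_congr rfl fun i _ => by rw [← sub_smul, hsplit]
  refine ⟨S⁻¹ • ∑ i, max (d i) 0 • x i, Set.eq_singleton_iff_unique_mem.2 ⟨?_, ?_⟩⟩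
  · refine Set.mem_iInter.2 fun i => mem_convexHull_image_compl_singleton.2 ?_
    rcases le_total (d i) 0 with h | h
    · refine ⟨fun j => S⁻¹ * max (d j) 0, fun j => by positivity, by simp [h], ?_, ?_⟩
      · rw [← Finset.mul_sum, ← hS, inv_mul_cancel₀ hSpos.ne']
      · simp only [mul_smul, Finset.smul_sum]
    · refine ⟨fun j => S⁻¹ * max (-d j) 0, fun j => by positivity, by simp [h], ?_, ?_⟩
      · rw [← Finset.mul_sum, hS', inv_mul_cancel₀ hSpos.ne']
      · rw [← hx']
        simp only [mul_smul, Finset.smul_sum]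
  · intro p hp
    choose w hw hwi hw1 hwx using fun i =>
      mem_convexHull_image_compl_singleton.1 (Set.mem_iInter.1 hp i)
    have hdiff (i j : ι) : ∃ c : ℝ, ∀ l, w i l - w j l = c * d l := by
      refine huniq (fun l => w i l - w j l) ?_ ?_
      · rw [Finset.sum_sub_distrib, hw1, hw1, sub_self]
      · simp only [sub_smul, Finset.sum_sub_distrib, hwx, sub_self]
    have hneg (i : ι) (hi : d i ≤ 0) : w b i = 0 := by
      obtain ⟨c, hc⟩ := hdiff b i
      have h1 := hc i
      have h2 := hc b
      rw [hwi] at h1 h2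
      have h3 : 0 ≤ c := by
        by_contra! h
        nlinarith [hw i b, mul_pos_of_neg_of_neg h hb]
      nlinarith [hw b i, mul_nonneg h3 (neg_nonneg.2 hi)]
    obtain ⟨c, hc⟩ := hdiff b a
    have hpos (i : ι) (hi : 0 < d i) : w a i = 0 := by
      obtain ⟨c, hc⟩ := hdiff a i
      have h1 := hc i
      have h2 := hc a
      rw [hwi] at h1 h2
      have h3 : c ≤ 0 := by
        by_contra! h
        nlinarith [hw i a, mul_pos h ha]
      nlinarith [hw a i, mul_nonneg (neg_nonneg.2 h3) hi.le]
    have hwb (i : ι) : w b i = c * max (d i) 0 := by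
      rcases le_or_gt (d i) 0 with h | h
      · simp [h, hneg i h]
      · rw [max_eq_left h.le, ← hc i, hpos i h, sub_zero]
    have hcS : c = S⁻¹ := by
      refine eq_inv_of_mul_eq_one_left ?_
      rw [hS, Finset.mul_sum, ← hw1 b]
      exact Finset.sum_congr rfl fun i _ => (hwb i).symm
    rw [← hwx b, ← hcS, Finset.smul_sum]
    exact Finset.sum_congr rfl fun i _ => by rw [hwb, mul_smul]

/-- Four points of the plane either lie on a line or have, up to scaling, exactly one
nontrivial affine dependency. -/
theorem exists_line_or_exists_unique_dependency (x : Fin 4 → EuclideanSpace ℝ (Fin 2)) :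
    (∃ (o v : EuclideanSpace ℝ (Fin 2)) (s : Fin 4 → ℝ), v ≠ 0 ∧ ∀ i, x i = o + s i • v) ∨
    ∃ d : Fin 4 → ℝ, d ≠ 0 ∧ ∑ i, d i = 0 ∧ ∑ i, d i • x i = 0 ∧
      ∀ w : Fin 4 → ℝ, ∑ i, w i = 0 → ∑ i, w i • x i = 0 → ∃ c : ℝ, ∀ i, w i = c * d i := by
  let D (i j k : Fin 4) : ℝ :=
    (x j 0 - x i 0) * (x k 1 - x i 1) - (x j 1 - x i 1) * (x k 0 - x i 0)
  let d : Fin 4 → ℝ := ![D 1 2 3, -D 0 2 3, D 0 1 3, -D 0 1 2]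
  by_cases hd : d = 0
  · left
    have h0 : D 1 2 3 = 0 := congrFun hd 0
    have h1 : -D 0 2 3 = 0 := congrFun hd 1
    have h2 : D 0 1 3 = 0 := congrFun hd 2
    have h3 : -D 0 1 2 = 0 := congrFun hd 3
    by_cases hx : ∃ i, x i ≠ x 0
    · obtain ⟨i, hi⟩ := hx
      have hD (j : Fin 4) : D 0 i j = 0 := by
        fin_cases i <;> fin_cases j <;> simp [D] at h1 h2 h3 ⊢ <;> linarith
      have hs (j : Fin 4) : ∃ s : ℝ, x j = x 0 + s • (x i - x 0) := by
        have hj := hD j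
        simp only [D] at hj
        by_cases hc : x i 0 - x 0 0 = 0
        · have hc' : x i 1 - x 0 1 ≠ 0 := by
            intro h
            refine hi (PiLp.ext fun l => ?_)
            fin_cases l
            · exact sub_eq_zero.1 hc
            · exact sub_eq_zero.1 h
          refine ⟨(x j 1 - x 0 1) / (x i 1 - x 0 1), PiLp.ext fun l => ?_⟩
          fin_cases l <;> simp <;> field_simp <;> linarith
        · refine ⟨(x j 0 - x 0 0) / (x i 0 - x 0 0), PiLp.ext fun l => ?_⟩
          fin_cases l <;> simp <;> field_simp <;> linarith
      choose s hs using hs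
      exact ⟨x 0, x i - x 0, s, sub_ne_zero.2 hi, hs⟩
    · push Not at hx
      obtain ⟨v, hv⟩ := exists_ne (0 : EuclideanSpace ℝ (Fin 2))
      exact ⟨x 0, v, 0, hv, fun i => by simp [hx i]⟩
  · right
    refine ⟨d, hd, ?_, ?_, ?_⟩
    · simp [Fin.sum_univ_four, d, D]
      ring
    · refine PiLp.ext fun l => ?_
      fin_cases l <;> simp [Fin.sum_univ_four, d, D] <;> ring
    · intro w hw hwx
      have hX : ∑ i, w i * x i 0 = 0 := by simpa using congrArg (fun z => z 0) hwx
      have hY : ∑ i, w i * x i 1 = 0 := by simpa using congrArg (fun z => z 1) hwx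
      have key (k l : Fin 4) : ∑ i, w i * D i k l = 0 := by
        simp only [Fin.sum_univ_four, D] at hw hX hY ⊢
        linear_combination (x k 0 * x l 1 - x k 1 * x l 0) * hw + (x k 1 - x l 1) * hX +
          (x l 0 - x k 0) * hY
      have hcross (i j : Fin 4) : w i * d j = w j * d i := by
        have h01 := key 0 1
        have h02 := key 0 2
        have h03 := key 0 3
        have h12 := key 1 2
        have h13 := key 1 3
        have h23 := key 2 3
        simp only [Fin.sum_univ_four, D] at h01 h02 h03 h12 h13 h23
        fin_cases i <;> fin_cases j <;> simp [d, D] <;> linarith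
      obtain ⟨k, hk⟩ := Function.ne_iff.1 hd
      refine ⟨w k / d k, fun i => ?_⟩
      rw [div_mul_eq_mul_div, eq_div_iff hk]
      exact hcross i k

/-- The convex hull of three reals is the interval between their minimum and maximum. -/
theorem Real.convexHull_triple (a b c : ℝ) :
    convexHull ℝ {a, b, c} = Set.Icc (min a (min b c)) (max a (max b c)) := by
  refine (convexHull_min ?_ (convex_Icc _ _)).antisymm fun t ht => ?_
  · rintro t (rfl | rfl | rfl) <;> simp
  · have hconv := (convex_convexHull ℝ ({a, b, c} : Set ℝ)).ordConnected
    have hsub := subset_convexHull ℝ ({a, b, c} : Set ℝ)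
    refine hconv.out (hsub ?_) (hsub ?_) ht
    · rcases min_choice b c with h | h <;> rw [h] <;>
        rcases min_choice a _ with h | h <;> rw [h] <;> simp
    · rcases max_choice b c with h | h <;> rw [h] <;>
        rcases max_choice a _ with h | h <;> rw [h] <;> simp

/-- For four reals, the intersection of the four intervals spanned by three of them is the
intersection of the segments of one of two pairings, and it is nonempty. -/
theorem Real.iInter_convexHull_triple (a b c d : ℝ) :
    ∃ l u : ℝ, l ≤ u ∧
      convexHull ℝ {a, b, c} ∩ convexHull ℝ {a, b, d} ∩ convexHull ℝ {a, c, d} ∩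
        convexHull ℝ {b, c, d} = Set.Icc l u ∧
      (segment ℝ a b ∩ segment ℝ c d = Set.Icc l u ∨
        segment ℝ a c ∩ segment ℝ b d = Set.Icc l u) := by
  simp only [Real.convexHull_triple, segment_eq_uIcc, Set.uIcc, Set.Icc_inter_Icc]
  refine ⟨_, _, ?_, rfl, ?_⟩
  · grind
  · refine Or.imp (and_imp.2 (congrArg₂ Set.Icc)) (and_imp.2 (congrArg₂ Set.Icc)) ?_
    by_cases h : min c d ≤ max a b ∧ min a b ≤ max c d
    · left
      constructor <;> rcases le_total a b with h1 | h1 <;> rcases le_total c d with h2 | h2 <;>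
        simp only [h1, h2, max_eq_left, max_eq_right, min_eq_left, min_eq_right] at h ⊢ <;> grind
    · right
      constructor <;> rcases le_total a b with h1 | h1 <;> rcases le_total c d with h2 | h2 <;>
        simp only [h1, h2, max_eq_left, max_eq_right, min_eq_left, min_eq_right] at h ⊢ <;> grind


/-- The Euclidean plane is 2-median: for any four points, either some pairing
of the four points into two pairs has opposite segments meeting in at least
two points, in which case the intersection of the four full triangles equals
that intersection of segments, or the intersection of the four full triangles
is a single point. -/
theorem plane_is_two_median (x₁ x₂ x₃ x₄ : EuclideanSpace ℝ (Fin 2)) :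
    (∃ a b : EuclideanSpace ℝ (Fin 2), a ≠ b ∧
      ((a ∈ segment ℝ x₁ x₂ ∩ segment ℝ x₃ x₄ ∧
          b ∈ segment ℝ x₁ x₂ ∩ segment ℝ x₃ x₄ ∧
          convexHull ℝ {x₁, x₂, x₃} ∩ convexHull ℝ {x₁, x₂, x₄} ∩
            convexHull ℝ {x₁, x₃, x₄} ∩ convexHull ℝ {x₂, x₃, x₄} =
            segment ℝ x₁ x₂ ∩ segment ℝ x₃ x₄) ∨
        (a ∈ segment ℝ x₁ x₃ ∩ segment ℝ x₂ x₄ ∧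
          b ∈ segment ℝ x₁ x₃ ∩ segment ℝ x₂ x₄ ∧
          convexHull ℝ {x₁, x₂, x₃} ∩ convexHull ℝ {x₁, x₂, x₄} ∩
            convexHull ℝ {x₁, x₃, x₄} ∩ convexHull ℝ {x₂, x₃, x₄} =
            segment ℝ x₁ x₃ ∩ segment ℝ x₂ x₄) ∨
        (a ∈ segment ℝ x₁ x₄ ∩ segment ℝ x₂ x₃ ∧
          b ∈ segment ℝ x₁ x₄ ∩ segment ℝ x₂ x₃ ∧
          convexHull ℝ {x₁, x₂, x₃} ∩ convexHull ℝ {x₁, x₂, x₄} ∩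
            convexHull ℝ {x₁, x₃, x₄} ∩ convexHull ℝ {x₂, x₃, x₄} =
            segment ℝ x₁ x₄ ∩ segment ℝ x₂ x₃))) ∨
    (∃ p : EuclideanSpace ℝ (Fin 2),
      convexHull ℝ {x₁, x₂, x₃} ∩ convexHull ℝ {x₁, x₂, x₄} ∩
        convexHull ℝ {x₁, x₃, x₄} ∩ convexHull ℝ {x₂, x₃, x₄} = {p}) := by
  rcases exists_line_or_exists_unique_dependency ![x₁, x₂, x₃, x₄] with
    ⟨o, v, s, hv, hs⟩ | ⟨d, hd, hd0, hdx, huniq⟩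
  · let f : ℝ →ᵃ[ℝ] EuclideanSpace ℝ (Fin 2) :=
      AffineMap.const ℝ ℝ o + (LinearMap.toSpanSingleton ℝ _ v).toAffineMap
    have hf : Function.Injective f := by
      intro a b hab
      simpa [f, hv] using hab
    obtain rfl : x₁ = f (s 0) := hs 0
    obtain rfl : x₂ = f (s 1) := hs 1
    obtain rfl : x₃ = f (s 2) := hs 2
    obtain rfl : x₄ = f (s 3) := hs 3
    have htriple (a b c : ℝ) : convexHull ℝ {f a, f b, f c} = f '' convexHull ℝ {a, b, c} := by
      rw [AffineMap.image_convexHull, Set.image_insert_eq, Set.image_pair]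
    simp only [htriple, ← image_segment, ← Set.image_inter hf]
    obtain ⟨l, u, hlu, hI, hseg⟩ := Real.iInter_convexHull_triple (s 0) (s 1) (s 2) (s 3)
    rw [hI]
    rcases hlu.eq_or_lt with rfl | hlt
    · exact Or.inr ⟨f l, by simp⟩
    · refine Or.inl ⟨f l, f u, hf.ne hlt.ne, ?_⟩
      have hl := Set.mem_image_of_mem f (Set.left_mem_Icc.2 hlu)
      have hu := Set.mem_image_of_mem f (Set.right_mem_Icc.2 hlu)
      rcases hseg with h | h <;> simp only [h]
      · exact Or.inl ⟨hl, hu, trivial⟩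
      · exact Or.inr (Or.inl ⟨hl, hu, trivial⟩)
  · right
    obtain ⟨p, hp⟩ := exists_iInter_convexHull_eq_singleton _ d hd hd0 hdx huniq
    refine ⟨p, hp ▸ ?_⟩
    have h0 : ({0}ᶜ : Set (Fin 4)) = {1, 2, 3} := by ext i; fin_cases i <;> simp
    have h1 : ({1}ᶜ : Set (Fin 4)) = {0, 2, 3} := by ext i; fin_cases i <;> simp
    have h2 : ({2}ᶜ : Set (Fin 4)) = {0, 1, 3} := by ext i; fin_cases i <;> simp
    have h3 : ({3}ᶜ : Set (Fin 4)) = {0, 1, 2} := by ext i; fin_cases i <;> simp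
    ext q
    simp [Fin.forall_fin_succ, h0, h1, h2, h3, Set.image_insert_eq]
    tauto
end

section
/- Let x₁, x₂, x₃ be affinely independent points in the Euclidean plane ℝ² and let x₄ ∈ conv{x₁, x₂, x₃}. Then the intersection of the four full triangles spanned by x₁, x₂, x₃, x₄ is exactly the singleton {x₄}: ⋂_{1 ≤ i < j < k ≤ 4} conv{x_i, x_j, x_k} = {x₄}. (This is the first of the two arrangements of four non-collinear points in the plane described in the paper's introduction.) -/
namespace AffineBasis

variable {ι E : Type*} [AddCommGroup E] [Module ℝ E]

/-- A barycentric coordinate that vanishes at two points and is nonnegative at a third one is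
maximal at the third point over the triangle they span. -/
theorem coord_le_of_mem_convexHull (b : AffineBasis ι ℝ E) {i j k : ι} (hj : i ≠ j) (hk : i ≠ k)
    {p y : E} (hp : 0 ≤ b.coord i p) (hy : y ∈ convexHull ℝ {b j, b k, p}) :
    b.coord i y ≤ b.coord i p := by
  have hconv : Convex ℝ (b.coord i ⁻¹' Set.Iic (b.coord i p)) :=
    (convex_Iic _).affine_preimage _
  refine convexHull_min ?_ hconv hy
  rintro z (rfl | rfl | rfl) <;> simp [b.coord_apply_ne, hj, hk, hp]

/-- Points are equal if the barycentric coordinates of one are dominated by those of the other. -/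
theorem eq_of_coord_le [Fintype ι] (b : AffineBasis ι ℝ E) {p y : E}
    (h : ∀ i, b.coord i y ≤ b.coord i p) : y = p := by
  refine b.ext_elem fun i => ?_
  have hsum : ∑ i, b.coord i y = ∑ i, b.coord i p := by
    rw [b.sum_coord_apply_eq_one, b.sum_coord_apply_eq_one]
  exact (Finset.sum_eq_sum_iff_of_le fun i _ => h i).1 hsum i (Finset.mem_univ i)

end AffineBasis


/-- If `x₁, x₂, x₃` are affinely independent in the Euclidean plane and
`x₄` lies in their convex hull, then the intersection of the four full
triangles spanned by the four points is exactly `{x₄}`. -/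
theorem four_triangles_inter_inside
    (x₁ x₂ x₃ x₄ : EuclideanSpace ℝ (Fin 2))
    (hind : AffineIndependent ℝ ![x₁, x₂, x₃])
    (h₄ : x₄ ∈ convexHull ℝ ({x₁, x₂, x₃} : Set (EuclideanSpace ℝ (Fin 2)))) :
    convexHull ℝ {x₁, x₂, x₃} ∩ convexHull ℝ {x₁, x₂, x₄} ∩
      convexHull ℝ {x₁, x₃, x₄} ∩ convexHull ℝ {x₂, x₃, x₄} = {x₄} := by
  have htop : affineSpan ℝ (Set.range ![x₁, x₂, x₃]) = ⊤ := by
    rw [hind.affineSpan_eq_top_iff_card_eq_finrank_add_one]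
    simp
  let b : AffineBasis (Fin 3) ℝ (EuclideanSpace ℝ (Fin 2)) := ⟨_, hind, htop⟩
  have hnonneg : ∀ i, 0 ≤ b.coord i x₄ := by
    have hrange : Set.range b = {x₁, x₂, x₃} := by
      change Set.range ![x₁, x₂, x₃] = _
      simp only [Matrix.range_cons, Matrix.range_empty, Set.union_empty, Set.singleton_union]
    rwa [← hrange, b.convexHull_eq_nonneg_coord] at h₄
  refine Set.Subset.antisymm ?_ ?_
  · rintro y ⟨⟨⟨-, h₁₂⟩, h₁₃⟩, h₂₃⟩
    refine b.eq_of_coord_le fun i => ?_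
    fin_cases i
    · exact b.coord_le_of_mem_convexHull (j := 1) (k := 2) (by decide) (by decide) (hnonneg 0) h₂₃
    · exact b.coord_le_of_mem_convexHull (j := 0) (k := 2) (by decide) (by decide) (hnonneg 1) h₁₃
    · exact b.coord_le_of_mem_convexHull (j := 0) (k := 1) (by decide) (by decide) (hnonneg 2) h₁₂
  · rintro _ rfl
    exact ⟨⟨⟨h₄, subset_convexHull ℝ _ (by simp)⟩, subset_convexHull ℝ _ (by simp)⟩,
      subset_convexHull ℝ _ (by simp)⟩
end

section
/- Let x₁, x₂, x₃, x₄ be four points in the Euclidean plane ℝ² that do not all lie on a common affine line, and suppose the closed segments [x₁,x₃] and [x₂,x₄] intersect. Then ⋂_{1 ≤ i < j < k ≤ 4} conv{x_i, x_j, x_k} = [x₁,x₃] ∩ [x₂,x₄], and this set is a single point. (This covers the second arrangement of four non-collinear points in the plane described in the paper's introduction, where the intersection point of the two diagonals is the unique point common to the four full triangles.) -/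
theorem exists_nonneg_coord_of_mem_convexHull {E : Type*} [AddCommGroup E] [Module ℝ E]
    {p u v q x y z : E} {a b c : ℝ} (hc : 0 ≤ c) (hx : x = p + a • u) (hy : y = p + b • u)
    (hz : z = p + c • v) (hq : q ∈ convexHull ℝ {x, y, z}) :
    ∃ α β : ℝ, 0 ≤ β ∧ q = p + α • u + β • v := by
  let S : Set E := {q | ∃ α β : ℝ, 0 ≤ β ∧ q = p + α • u + β • v}
  have hS : Convex ℝ S := by
    rintro _ ⟨α, β, hβ, rfl⟩ _ ⟨α', β', hβ', rfl⟩ s t hs ht hst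
    refine ⟨s * α + t * α', s * β + t * β', by positivity, ?_⟩
    obtain rfl : t = 1 - s := by linarith
    module
  refine convexHull_min ?_ hS hq
  rintro w (rfl | rfl | rfl)
  · exact ⟨a, 0, le_rfl, by simp [hx]⟩
  · exact ⟨b, 0, le_rfl, by simp [hy]⟩
  · exact ⟨0, c, hc, by simp [hz]⟩

/-- If four points of the Euclidean plane do not all lie on a common affine
line and the diagonals `[x₁,x₃]` and `[x₂,x₄]` intersect, then the
intersection of the four full triangles equals `[x₁,x₃] ∩ [x₂,x₄]`, which is a
single point. -/
theorem four_triangles_inter_diagonals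
    (x₁ x₂ x₃ x₄ : EuclideanSpace ℝ (Fin 2))
    (h : ¬ Collinear ℝ ({x₁, x₂, x₃, x₄} : Set (EuclideanSpace ℝ (Fin 2))))
    (hd : (segment ℝ x₁ x₃ ∩ segment ℝ x₂ x₄).Nonempty) :
    convexHull ℝ {x₁, x₂, x₃} ∩ convexHull ℝ {x₁, x₂, x₄} ∩
        convexHull ℝ {x₁, x₃, x₄} ∩ convexHull ℝ {x₂, x₃, x₄} =
      segment ℝ x₁ x₃ ∩ segment ℝ x₂ x₄ ∧
    ∃ p : EuclideanSpace ℝ (Fin 2),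
      segment ℝ x₁ x₃ ∩ segment ℝ x₂ x₄ = {p} := by
  obtain ⟨p, hp₁, hp₂⟩ := hd
  have hsub : segment ℝ x₁ x₃ ∩ segment ℝ x₂ x₄ ⊆
      convexHull ℝ {x₁, x₂, x₃} ∩ convexHull ℝ {x₁, x₂, x₄} ∩
        convexHull ℝ {x₁, x₃, x₄} ∩ convexHull ℝ {x₂, x₃, x₄} := by
    rintro q ⟨hq₁, hq₂⟩
    refine ⟨⟨⟨?_, ?_⟩, ?_⟩, ?_⟩
    · exact segment_subset_convexHull (by simp) (by simp) hq₁
    · exact segment_subset_convexHull (by simp) (by simp) hq₂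
    · exact segment_subset_convexHull (by simp) (by simp) hq₁
    · exact segment_subset_convexHull (by simp) (by simp) hq₂
  have hp : p ∈ segment ℝ x₁ x₃ ∩ segment ℝ x₂ x₄ := ⟨hp₁, hp₂⟩
  suffices hle : convexHull ℝ {x₁, x₂, x₃} ∩ convexHull ℝ {x₁, x₂, x₄} ∩
      convexHull ℝ {x₁, x₃, x₄} ∩ convexHull ℝ {x₂, x₃, x₄} ⊆ {p} by
    refine ⟨(hle.trans (Set.singleton_subset_iff.2 hp)).antisymm hsub, p, ?_⟩
    exact (hsub.trans hle).antisymm (Set.singleton_subset_iff.2 hp)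
  rw [segment_eq_image'] at hp₁ hp₂
  obtain ⟨s, ⟨hs₀, hs₁⟩, hs⟩ := hp₁
  obtain ⟨t, ⟨ht₀, ht₁⟩, ht⟩ := hp₂
  obtain ⟨u, hu⟩ : ∃ u, u = x₃ - x₁ := ⟨_, rfl⟩
  obtain ⟨v, hv⟩ : ∃ v, v = x₄ - x₂ := ⟨_, rfl⟩
  have e₁ : x₁ = p + (-s) • u := by rw [← hs, hu]; module
  have e₃ : x₃ = p + (1 - s) • u := by rw [← hs, hu]; module
  have e₂ : x₂ = p + (-t) • v := by rw [← ht, hv]; module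
  have e₄ : x₄ = p + (1 - t) • v := by rw [← ht, hv]; module
  have hne : ∀ w : EuclideanSpace ℝ (Fin 2), ∀ k l : ℝ, u = k • w → v = l • w → False := by
    rintro w k l hk hl
    refine h ((collinear_iff_exists_forall_eq_smul_vadd _).2 ⟨p, w, ?_⟩)
    rintro x (hx | hx | hx | hx)
    · exact ⟨-s * k, by rw [hx, e₁, hk, vadd_eq_add]; module⟩
    · exact ⟨-t * l, by rw [hx, e₂, hl, vadd_eq_add]; module⟩
    · exact ⟨(1 - s) * k, by rw [hx, e₃, hk, vadd_eq_add]; module⟩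
    · exact ⟨(1 - t) * l, by rw [hx, e₄, hl, vadd_eq_add]; module⟩
  have hli : ∀ a b : ℝ, a • u + b • v = 0 → a = 0 ∧ b = 0 := by
    intro a b hab
    constructor
    · by_contra ha
      refine hne v (-(a⁻¹ * b)) 1 ?_ (one_smul ℝ v).symm
      linear_combination (norm := module) a⁻¹ • hab - (inv_mul_cancel₀ ha) • u
    · by_contra hb
      refine hne u 1 (-(b⁻¹ * a)) (one_smul ℝ u).symm ?_
      linear_combination (norm := module) b⁻¹ • hab - (inv_mul_cancel₀ hb) • v
  have hinj : ∀ {a b a' b' : ℝ}, p + a • u + b • v = p + a' • u + b' • v → a = a' ∧ b = b' := by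
    intro a b a' b' hab
    have := hli (a - a') (b - b') (by linear_combination (norm := module) hab)
    exact ⟨sub_eq_zero.1 this.1, sub_eq_zero.1 this.2⟩
  rintro q ⟨⟨⟨h₁₂₃, h₁₂₄⟩, h₁₃₄⟩, h₂₃₄⟩
  rw [Set.pair_comm x₂ x₃] at h₁₂₃
  rw [Set.insert_comm, Set.pair_comm x₁ x₄] at h₁₂₄
  rw [Set.pair_comm x₃ x₄] at h₂₃₄
  obtain ⟨a, b, hb, hq₁⟩ := exists_nonneg_coord_of_mem_convexHull (v := -v) ht₀ e₁ e₃
    (by rw [e₂]; module) h₁₂₃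
  obtain ⟨a', b', hb', hq₂⟩ := exists_nonneg_coord_of_mem_convexHull (sub_nonneg.2 ht₁) e₁ e₃
    e₄ h₁₃₄
  obtain ⟨c, d, hd, hq₃⟩ := exists_nonneg_coord_of_mem_convexHull (v := -u) hs₀ e₂ e₄
    (by rw [e₁]; module) h₁₂₄
  obtain ⟨c', d', hd', hq₄⟩ := exists_nonneg_coord_of_mem_convexHull (sub_nonneg.2 hs₁) e₂ e₄
    e₃ h₂₃₄
  have h₁ := hinj (a := a) (b := -b) (a' := a') (b' := b') (by rw [← hq₂, hq₁]; module)
  have h₂ := hinj (a := -d) (b := c) (a' := a') (b' := b') (by rw [← hq₂, hq₃]; module)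
  have h₃ := hinj (a := d') (b := c') (a' := a') (b' := b') (by rw [← hq₂, hq₄]; module)
  have ha₀ : a' = 0 := by linarith [h₂.1, h₃.1]
  have hb₀ : b' = 0 := by linarith [h₁.2]
  simp [hq₂, ha₀, hb₀]
end
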